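/- Let n ≥ 3, let f ∈ ℤ/nℤ, and let S be a minimum dominating set of P_f(n,2). If S contains at least one vertex of N(u_f) = {u_{f−1}, u_{f+1}, v_f} (the neighborhood of u_f in P(n,2)), then |S| = ⌈3n/5⌉. -/

import Mathlib

namespace PetersenDom

/-- Vertex set of the generalized Petersen graph: `Sum.inl i` is the outer
vertex `u_i`, `Sum.inr i` is the inner vertex `v_i`, indices in `ZMod n`. -/
abbrev PVert (n : ℕ) := ZMod n ⊕ ZMod n

/-- The outer vertex `u_i`. -/
def uV {n : ℕ} (i : ZMod n) : PVert n := Sum.inl i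

/-- The inner vertex `v_i`. -/
def vV {n : ℕ} (i : ZMod n) : PVert n := Sum.inr i

/-- The generalized Petersen graph `P(n,2)`, with edges
`u_i u_{i+1}`, `u_i v_i`, `v_i v_{i+2}` (indices mod `n`). -/
def P2 (n : ℕ) : SimpleGraph (PVert n) :=
  SimpleGraph.fromRel (fun a b =>
    (∃ i : ZMod n, a = uV i ∧ b = uV (i + 1)) ∨
    (∃ i : ZMod n, a = uV i ∧ b = vV i) ∨
    (∃ i : ZMod n, a = vV i ∧ b = vV (i + 2)))

/-- `S` is a dominating set of `G`: every vertex is in `S` or adjacent to a vertex of `S`. -/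
def IsDomSet {V : Type*} (G : SimpleGraph V) (S : Set V) : Prop :=
  ∀ v : V, v ∈ S ∨ ∃ u ∈ S, G.Adj u v

/-- The domination number of `G`. -/
noncomputable def domNum {V : Type*} (G : SimpleGraph V) : ℕ :=
  sInf {k | ∃ S : Set V, IsDomSet G S ∧ S.ncard = k}

/-- `S` is a dominating set of `P_f(n,2) = P(n,2) - u_f`: it avoids `u_f`
and dominates every vertex other than `u_f`. -/
def IsDomSetF (n : ℕ) (f : ZMod n) (S : Set (PVert n)) : Prop :=
  uV f ∉ S ∧ ∀ v : PVert n, v ≠ uV f → v ∈ S ∨ ∃ u ∈ S, (P2 n).Adj u v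

/-- The domination number of `P_f(n,2)`. -/
noncomputable def domNumF (n : ℕ) (f : ZMod n) : ℕ :=
  sInf {k | ∃ S : Set (PVert n), IsDomSetF n f S ∧ S.ncard = k}

/-- `S` is a minimum dominating set of `P_f(n,2)`. -/
def MinDomF (n : ℕ) (f : ZMod n) (S : Set (PVert n)) : Prop :=
  IsDomSetF n f S ∧ S.ncard = domNumF n f

/-- The neighborhood `N(u_f) = {u_{f-1}, u_{f+1}, v_f}` of `u_f` in `P(n,2)`. -/
def Nbr (n : ℕ) (f : ZMod n) : Set (PVert n) := {uV (f - 1), uV (f + 1), vV f}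

/-- The block `B_i`: the 5 consecutive pairs of vertices centered at `u_i, v_i`. -/
def Blk (n : ℕ) (i : ZMod n) : Set (PVert n) :=
  {uV (i-2), uV (i-1), uV i, uV (i+1), uV (i+2),
   vV (i-2), vV (i-1), vV i, vV (i+1), vV (i+2)}

/-- `γ_i(S) = |B_i ∩ S|`. -/
noncomputable def gam (n : ℕ) (i : ZMod n) (S : Set (PVert n)) : ℕ :=
  (Blk n i ∩ S).ncard

/-- `L_i = {v_{i-1}, u_{i-2}, v_{i-2}}`. -/
def Lset (n : ℕ) (i : ZMod n) : Set (PVert n) := {vV (i-1), uV (i-2), vV (i-2)}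

/-- `R_i = {v_{i+1}, u_{i+2}, v_{i+2}}`. -/
def Rset (n : ℕ) (i : ZMod n) : Set (PVert n) := {vV (i+1), uV (i+2), vV (i+2)}

/-- `M_i = {u_{i-1}, v_i, u_{i+1}}`. -/
def Mset (n : ℕ) (i : ZMod n) : Set (PVert n) := {uV (i-1), vV i, uV (i+1)}

/-- `F = {f-2, f-1, f, f+1, f+2}`, the indices of the block `B_f`. -/
def Fset (n : ℕ) (f : ZMod n) : Set (ZMod n) := {f-2, f-1, f, f+1, f+2}

/-- A Type I set: a minimum dominating set `S` of `P_f(n,2)` with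
`γ_i(S) ≥ 2` for all `i`. -/
def TypeI (n : ℕ) (f : ZMod n) (S : Set (PVert n)) : Prop :=
  MinDomF n f S ∧ ∀ i : ZMod n, 2 ≤ gam n i S

/-- The couple number of `S`: the number of indices `i ∉ F` with `γ_i(S) = 2`. -/
noncomputable def coupleNum (n : ℕ) (f : ZMod n) (S : Set (PVert n)) : ℕ :=
  {i : ZMod n | gam n i S = 2 ∧ i ∉ Fset n f}.ncard

/-- A Type II set: a Type I set with `N(u_f) ∩ S = ∅`, `γ_f(S) = 3`, and
`B_f ∩ S = {u_{f-2}, v_{f+1}, v_{f+2}}`. -/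
def TypeII (n : ℕ) (f : ZMod n) (S : Set (PVert n)) : Prop :=
  TypeI n f S ∧ Nbr n f ∩ S = ∅ ∧ gam n f S = 3 ∧
    Blk n f ∩ S = {uV (f-2), vV (f+1), vV (f+2)}

/-- A Type III set: a Type I set with `N(u_f) ∩ S = ∅`, `γ_f(S) = 4`, and
`B_f ∩ S` one of four specified patterns. -/
def TypeIII (n : ℕ) (f : ZMod n) (S : Set (PVert n)) : Prop :=
  TypeI n f S ∧ Nbr n f ∩ S = ∅ ∧ gam n f S = 4 ∧
    (Blk n f ∩ S = {vV (f-1), vV (f+1), uV (f+2), vV (f+2)} ∨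
     Blk n f ∩ S = {uV (f-2), vV (f-2), uV (f+2), vV (f+2)} ∨
     Blk n f ∩ S = {vV (f-2), vV (f-1), vV (f+1), vV (f+2)} ∨
     Blk n f ∩ S = {uV (f-2), vV (f-2), vV (f+1), uV (f+2)})

/-- `⌈3n/5⌉`. -/
noncomputable def ceil35 (n : ℕ) : ℕ := ⌈(3 * (n : ℚ)) / 5⌉₊

/-- The bondage number of `G`: the least number of edges whose deletion
increases the domination number. -/
noncomputable def bondage {V : Type*} (G : SimpleGraph V) : ℕ :=
  sInf {k | ∃ E : Set (Sym2 V), E ⊆ G.edgeSet ∧ E.ncard = k ∧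
    domNum G < domNum (G.deleteEdges E)}

/-- The domination alteration number of `G`: the least number of vertices
whose removal changes the domination number. -/
noncomputable def alterNum {V : Type*} (G : SimpleGraph V) : ℕ :=
  sInf {k | ∃ A : Set V, A.ncard = k ∧ domNum (G.induce Aᶜ) ≠ domNum G}

end PetersenDom
namespace PetersenDom

open Classical in
/-- The outer indicator of `S`. -/
noncomputable def outerInd {n : ℕ} (S : Set (PVert n)) (i : ZMod n) : Bool := decide (uV i ∈ S)

open Classical in
/-- The inner indicator of `S`. -/
noncomputable def innerInd {n : ℕ} (S : Set (PVert n)) (i : ZMod n) : Bool := decide (vV i ∈ S)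

/-- A potential on windows of a dominating set: the arguments indicate `u_{i-1}`, `u_i` and
`v_{i-2}`, `v_{i-1}`, `v_i`, `v_{i+1}`. -/
def potential (a b v₀ v₁ v₂ v₃ : Bool) : ℤ :=
  if a then
    if v₀ then 0
    else if v₁ then (if v₂ then -5 else -2)
    else (if v₂ then -4 else -1)
  else if v₀ then
    if v₁ then -5
    else if b then (if v₃ then -5 else -3)
    else 0
  else if v₁ then -7
  else if v₃ then (if b then (if v₂ then -7 else -6) else -4)
  else -3

theorem potential_step : ∀ a b c v₀ v₁ v₂ v₃ v₄ : Bool,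
    (a || b || c || v₂) = true → (v₀ || v₂ || v₄ || b) = true →
    potential b c v₁ v₂ v₃ v₄ + 3 ≤ potential a b v₀ v₁ v₂ v₃ + 5 * (b.toNat + v₁.toNat) := by
  decide

theorem adj_cases {n : ℕ} {x y : PVert n} (h : (P2 n).Adj x y) :
    (∃ i, x = uV i ∧ y = uV (i + 1)) ∨ (∃ i, x = uV (i + 1) ∧ y = uV i) ∨
    (∃ i, x = uV i ∧ y = vV i) ∨ (∃ i, x = vV i ∧ y = uV i) ∨
    (∃ i, x = vV i ∧ y = vV (i + 2)) ∨ (∃ i, x = vV (i + 2) ∧ y = vV i) := by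
  simp only [P2, SimpleGraph.fromRel_adj] at h
  grind

theorem outer_of_isDomSet {n : ℕ} {S : Set (PVert n)} (h : IsDomSet (P2 n) S) (i : ZMod n) :
    (outerInd S (i - 1) || outerInd S i || outerInd S (i + 1) || innerInd S i) = true := by
  simp only [outerInd, innerInd, Bool.or_eq_true, decide_eq_true_eq]
  rcases h (uV i) with h | ⟨x, hx, hadj⟩
  · tauto
  · rcases adj_cases hadj with ⟨j, rfl, hj⟩ | ⟨j, rfl, hj⟩ | ⟨j, rfl, hj⟩ | ⟨j, rfl, hj⟩ |
      ⟨j, rfl, hj⟩ | ⟨j, rfl, hj⟩ <;> simp only [uV, vV, Sum.inl.injEq, reduceCtorEq] at hj <;>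
      subst hj <;> simp_all [uV, vV]

theorem inner_of_isDomSet {n : ℕ} {S : Set (PVert n)} (h : IsDomSet (P2 n) S) (i : ZMod n) :
    (innerInd S (i - 2) || innerInd S i || innerInd S (i + 2) || outerInd S i) = true := by
  simp only [outerInd, innerInd, Bool.or_eq_true, decide_eq_true_eq]
  rcases h (vV i) with h | ⟨x, hx, hadj⟩
  · tauto
  · rcases adj_cases hadj with ⟨j, rfl, hj⟩ | ⟨j, rfl, hj⟩ | ⟨j, rfl, hj⟩ | ⟨j, rfl, hj⟩ |
      ⟨j, rfl, hj⟩ | ⟨j, rfl, hj⟩ <;> simp only [uV, vV, Sum.inr.injEq, reduceCtorEq] at hj <;>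
      subst hj <;> simp_all [uV, vV]

theorem ncard_eq_sum_ind {n : ℕ} [NeZero n] (S : Set (PVert n)) :
    S.ncard = ∑ i, (outerInd S i).toNat + ∑ i, (innerInd S i).toNat := by
  classical
  have h : ∀ p : Prop, ∀ d : Decidable p, (@decide p d).toNat = if p then 1 else 0 := by
    intro p d; by_cases hp : p <;> simp [hp]
  simp only [outerInd, innerInd, h]
  rw [Set.ncard_eq_toFinset_card', ← Set.filter_mem_univ_eq_toFinset, Finset.card_filter,
    Fintype.sum_sum_type]
  rfl

theorem three_mul_le_five_mul_ncard {n : ℕ} [NeZero n] {S : Set (PVert n)}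
    (h : IsDomSet (P2 n) S) : 3 * n ≤ 5 * S.ncard := by
  let U := outerInd S
  let V := innerInd S
  let g : ZMod n → ℤ := fun i => potential (U (i - 1)) (U i) (V (i - 2)) (V (i - 1)) (V i) (V (i + 1))
  have step : ∀ i, g (i + 1) + 3 ≤ g i + 5 * ((U i).toNat + (V (i - 1)).toNat) := by
    intro i
    have e₁ : i + 1 - 1 = i := by ring
    have e₂ : i + 1 - 2 = i - 1 := by ring
    have e₃ : i + 1 + 1 = i + 2 := by ring
    simp only [g, e₁, e₂, e₃]
    exact potential_step _ _ _ _ _ _ _ _ (outer_of_isDomSet h i) (inner_of_isDomSet h i)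
  have hsum := Finset.sum_le_sum fun i (_ : i ∈ Finset.univ) => step i
  have hg : ∑ i, g (i + 1) = ∑ i, g i := Equiv.sum_comp (Equiv.addRight (1 : ZMod n)) g
  have hV : ∑ i, ((V (i - 1)).toNat : ℤ) = ∑ i, ((V i).toNat : ℤ) :=
    Equiv.sum_comp (Equiv.subRight (1 : ZMod n)) fun i => ((V i).toNat : ℤ)
  simp only [Finset.sum_add_distrib, ← Finset.mul_sum, hg, hV, Finset.sum_const,
    Finset.card_univ, ZMod.card, nsmul_eq_mul] at hsum
  have hcard := ncard_eq_sum_ind S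
  zify at hcard ⊢
  rw [hcard]
  linarith

/-- `A` and `B` are the positions of the outer and inner vertices of a dominating pattern on `m`
consecutive columns, to be followed by a pattern containing the outer vertex of its column `0`
and the inner vertex of its column `1`. -/
def IsPattern (m : ℕ) (A B : Finset ℕ) : Prop :=
  0 ∈ A ∧ 1 ∈ B ∧ 1 ∉ A ∧ (∀ a ∈ A, a < m) ∧ ∀ j < m,
    (j ∈ A ∨ j ∈ B ∨ j + 1 ∈ A ∨ j + 1 = m ∨ ∃ a ∈ A, a + 1 = j) ∧
    (j ∈ A ∨ j ∈ B ∨ j + 2 ∈ B ∨ j + 1 = m ∨ ∃ b ∈ B, b + 2 = j)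

instance (m : ℕ) (A B : Finset ℕ) : Decidable (IsPattern m A B) := by
  unfold IsPattern; infer_instance

theorem IsPattern.prepend {m : ℕ} {A B : Finset ℕ} (h : IsPattern m A B) :
    IsPattern (m + 5) ({0, 2} ∪ A.image (· + 5)) ({1} ∪ B.image (· + 5)) := by
  obtain ⟨h₀, h₁, -, hlt, hdom⟩ := h
  refine ⟨by simp, by simp, by simp, ?_, ?_⟩
  · intro a ha
    simp only [Finset.mem_union, Finset.mem_insert, Finset.mem_singleton, Finset.mem_image] at ha
    rcases ha with (rfl | rfl) | ⟨b, hb, rfl⟩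
    · omega
    · omega
    · have := hlt b hb
      omega
  · intro j hj
    simp only [Finset.mem_union, Finset.mem_insert, Finset.mem_singleton, Finset.mem_image]
    rcases lt_or_ge j 5 with hj' | hj'
    · interval_cases j <;> simp [h₀, h₁]
    · obtain ⟨i, rfl⟩ := Nat.exists_eq_add_of_le' hj'
      have := hdom i (by omega)
      grind

theorem exists_isPattern (n : ℕ) (hn : 3 ≤ n) :
    ∃ A B, IsPattern n A B ∧ 5 * (A.card + B.card) ≤ 3 * n + 4 := by
  induction n using Nat.strong_induction_on with
  | _ n ih =>
    rcases lt_or_ge n 8 with h | h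
    · interval_cases n
      · exact ⟨{0}, {1}, by decide, by decide⟩
      · exact ⟨{0, 2}, {1}, by decide, by decide⟩
      · exact ⟨{0, 2}, {1}, by decide, by decide⟩
      · exact ⟨{0, 2}, {1, 4}, by decide, by decide⟩
      · exact ⟨{0, 2, 4}, {1, 5}, by decide, by decide⟩
    · obtain ⟨m, rfl⟩ := Nat.exists_eq_add_of_le' (show 5 ≤ n by omega)
      obtain ⟨A, B, hAB, hc⟩ := ih m (by omega) (by omega)
      refine ⟨_, _, hAB.prepend, ?_⟩
      have hA := (Finset.card_union_le {0, 2} (A.image (· + 5))).trans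
        (Nat.add_le_add (Finset.card_le_two) Finset.card_image_le)
      have hB := (Finset.card_union_le {1} (B.image (· + 5))).trans
        (Nat.add_le_add (Finset.card_singleton 1).le Finset.card_image_le)
      omega

theorem dominated_outer {n : ℕ} {S : Set (PVert n)} {i : ZMod n}
    (h : uV i ∈ S ∨ vV i ∈ S ∨ uV (i + 1) ∈ S ∨ uV (i - 1) ∈ S) :
    uV i ∈ S ∨ ∃ x ∈ S, (P2 n).Adj x (uV i) := by
  by_cases hi : uV i ∈ S
  · exact Or.inl hi
  right
  rcases h with h | h | h | h
  · exact absurd h hi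
  all_goals
    refine ⟨_, h, ?_⟩
    rw [P2, SimpleGraph.fromRel_adj]
    refine ⟨fun e => hi (e ▸ h), ?_⟩
  · exact Or.inr (Or.inr (Or.inl ⟨i, rfl, rfl⟩))
  · exact Or.inr (Or.inl ⟨i, rfl, rfl⟩)
  · exact Or.inl (Or.inl ⟨i - 1, rfl, by simp⟩)

theorem dominated_inner {n : ℕ} {S : Set (PVert n)} {i : ZMod n}
    (h : uV i ∈ S ∨ vV i ∈ S ∨ vV (i + 2) ∈ S ∨ vV (i - 2) ∈ S) :
    vV i ∈ S ∨ ∃ x ∈ S, (P2 n).Adj x (vV i) := by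
  by_cases hi : vV i ∈ S
  · exact Or.inl hi
  right
  rcases h with h | h | h | h
  · refine ⟨_, h, ?_⟩
    rw [P2, SimpleGraph.fromRel_adj]
    exact ⟨fun e => hi (e ▸ h), Or.inl (Or.inr (Or.inl ⟨i, rfl, rfl⟩))⟩
  · exact absurd h hi
  all_goals
    refine ⟨_, h, ?_⟩
    rw [P2, SimpleGraph.fromRel_adj]
    refine ⟨fun e => hi (e ▸ h), ?_⟩
  · exact Or.inr (Or.inr (Or.inr ⟨i, rfl, rfl⟩))
  · exact Or.inl (Or.inr (Or.inr ⟨i - 2, rfl, by simp⟩))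

/-- A pattern on `n` columns, rotated so that `u_f` is the outer vertex of column `1`, dominates
`P_f(n,2)`. -/
theorem IsPattern.domNumF_le {n : ℕ} (hn : 3 ≤ n) (f : ZMod n) {A B : Finset ℕ}
    (h : IsPattern n A B) : domNumF n f ≤ A.card + B.card := by
  have : NeZero n := ⟨by omega⟩
  obtain ⟨h₀, h₁, h₂, hlt, hdom⟩ := h
  let p : ℕ → ZMod n := fun j => f - 1 + j
  have hp : p n = p 0 := by simp [p]
  have hp₁ : p (n + 1) = p 1 := by simp [p]
  let a : Finset (PVert n) := A.image fun j => uV (p j)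
  let b : Finset (PVert n) := B.image fun j => vV (p j)
  let S : Set (PVert n) := ↑(a ∪ b)
  have hU : ∀ j ∈ A, uV (p j) ∈ S := fun j hj => by
    simp only [S, a, Finset.coe_union, Set.mem_union, Finset.mem_coe]
    exact Or.inl (Finset.mem_image_of_mem _ hj)
  have hV : ∀ j ∈ B, vV (p j) ∈ S := fun j hj => by
    simp only [S, b, Finset.coe_union, Set.mem_union, Finset.mem_coe]
    exact Or.inr (Finset.mem_image_of_mem _ hj)
  have hsucc : ∀ j, p j + 1 = p (j + 1) := fun j => by simp only [p]; push_cast; ring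
  have hsucc₂ : ∀ j, p j + 2 = p (j + 2) := fun j => by simp only [p]; push_cast; ring
  have hpred : ∀ j, p (j + 1) - 1 = p j := fun j => by simp only [p]; push_cast; ring
  have hpred₂ : ∀ j, p (j + 2) - 2 = p j := fun j => by simp only [p]; push_cast; ring
  have hsurj : ∀ i : ZMod n, ∃ j < n, p j = i := fun i =>
    ⟨(i - (f - 1)).val, ZMod.val_lt _, by simp [p]⟩
  have hS : IsDomSetF n f S := by
    refine ⟨?_, ?_⟩
    · intro hf
      simp only [S, a, b, Finset.coe_union, Set.mem_union, Finset.mem_coe, Finset.mem_image,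
        uV, vV, Sum.inl.injEq, reduceCtorEq, and_false, exists_false, or_false] at hf
      obtain ⟨j, hj, hjf⟩ := hf
      have hj₁ : (j : ZMod n) = (1 : ℕ) := by
        simp only [p] at hjf
        push_cast
        linear_combination hjf
      rw [ZMod.natCast_eq_natCast_iff', Nat.mod_eq_of_lt (hlt j hj),
        Nat.mod_eq_of_lt (by omega)] at hj₁
      exact h₂ (hj₁ ▸ hj)
    · rintro (i | i) -
      · obtain ⟨j, hj, rfl⟩ := hsurj i
        apply dominated_outer
        rcases (hdom j hj).1 with h | h | h | h | ⟨c, hc, rfl⟩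
        · exact Or.inl (hU j h)
        · exact Or.inr (Or.inl (hV j h))
        · exact Or.inr (Or.inr (Or.inl (hsucc j ▸ hU _ h)))
        · exact Or.inr (Or.inr (Or.inl (by rw [hsucc, h, hp]; exact hU 0 h₀)))
        · exact Or.inr (Or.inr (Or.inr (by rw [hpred]; exact hU c hc)))
      · obtain ⟨j, hj, rfl⟩ := hsurj i
        apply dominated_inner
        rcases (hdom j hj).2 with h | h | h | h | ⟨c, hc, rfl⟩
        · exact Or.inl (hU j h)
        · exact Or.inr (Or.inl (hV j h))
        · exact Or.inr (Or.inr (Or.inl (hsucc₂ j ▸ hV _ h)))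
        · refine Or.inr (Or.inr (Or.inl ?_))
          rw [hsucc₂, show j + 2 = n + 1 by omega, hp₁]
          exact hV 1 h₁
        · exact Or.inr (Or.inr (Or.inr (by rw [hpred₂]; exact hV c hc)))
  have hle : domNumF n f ≤ S.ncard := Nat.sInf_le ⟨S, hS, rfl⟩
  refine hle.trans ?_
  rw [Set.ncard_coe_finset]
  exact (Finset.card_union_le _ _).trans
    (Nat.add_le_add Finset.card_image_le Finset.card_image_le)

/-- A dominating set of `P_f(n,2)` meeting `N(u_f)` dominates `P(n,2)`. -/
theorem IsDomSetF.isDomSet {n : ℕ} {f : ZMod n} {S : Set (PVert n)} (hS : IsDomSetF n f S)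
    (hnbr : (Nbr n f ∩ S).Nonempty) : IsDomSet (P2 n) S := by
  intro v
  by_cases hv : v = uV f
  · subst hv
    apply dominated_outer
    obtain ⟨x, hx, hxS⟩ := hnbr
    simp only [Nbr, Set.mem_insert_iff, Set.mem_singleton_iff] at hx
    rcases hx with rfl | rfl | rfl <;> tauto
  · exact hS.2 v hv

/-- If a minimum dominating set `S` of `P_f(n,2)` contains a
vertex of `N(u_f) = {u_{f-1}, u_{f+1}, v_f}`, then `|S| = ⌈3n/5⌉`. -/
theorem minDom_nbr_card (n : ℕ) (hn : 3 ≤ n) (f : ZMod n) (S : Set (PVert n))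
    (hS : MinDomF n f S) (hnbr : (Nbr n f ∩ S).Nonempty) :
    S.ncard = ceil35 n := by
  have : NeZero n := ⟨by omega⟩
  have hlow := three_mul_le_five_mul_ncard (hS.1.isDomSet hnbr)
  obtain ⟨A, B, hAB, hc⟩ := exists_isPattern n hn
  have hup : 5 * S.ncard ≤ 3 * n + 4 := by
    have := hAB.domNumF_le hn f
    rw [hS.2]
    omega
  symm
  rw [ceil35, Nat.ceil_eq_iff (by intro h; omega)]
  have hpos : 1 ≤ S.ncard := by omega
  constructor
  · rw [Nat.cast_sub hpos, lt_div_iff₀ (by norm_num)]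
    have : (5 * S.ncard : ℚ) ≤ 3 * n + 4 := by exact_mod_cast hup
    push_cast
    linarith
  · rw [div_le_iff₀ (by norm_num)]
    have : (3 * n : ℚ) ≤ 5 * S.ncard := by exact_mod_cast hlow
    linarith

end PetersenDom
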